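/- Let n be a positive natural number with n ≡ 0 (mod 4). Let (r_j)_{j≥1} be nonnegative integers, all but finitely many equal to zero, such that r_1 is even, and suppose there is a natural number ℓ with ℓ ≤ α(n), ∑_{j≥1} r_j(2^j − 1) = n − ℓ, and ∑_{j≥1} r_j ≤ ℓ. Then ℓ = α(n) and r_j = ε_j(n) for every j ≥ 1. -/

import Mathlib

/-- `alpha n` is the number of 1's in the binary expansion of `n`. -/
def alpha (n : ℕ) : ℕ := (Nat.digits 2 n).sum

/-- `eps N j` is the coefficient of `2^j` in the binary expansion of `N`. -/
def eps (N j : ℕ) : ℕ := N / 2 ^ j % 2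

theorem alpha_rec (n : ℕ) : alpha n = n % 2 + alpha (n / 2) := by
  unfold alpha
  rcases Nat.eq_zero_or_pos n with h | h
  · subst h; simp
  · rw [Nat.digits_def' (by norm_num) h]; simp

theorem alpha_zero' : alpha 0 = 0 := by simp [alpha]

theorem alpha_le_self (n : ℕ) : alpha n ≤ n := Nat.digit_sum_le 2 n

theorem alpha_add (a : ℕ) : ∀ b, alpha (a + b) ≤ alpha a + alpha b := by
  have key : ∀ s a b, a + b ≤ s → alpha (a + b) ≤ alpha a + alpha b := by
    intro s
    induction s with
    | zero =>
      intro a b h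
      obtain rfl : a = 0 := by omega
      simp
    | succ s ih =>
      intro a b h
      rcases Nat.eq_zero_or_pos a with ha | ha
      · subst ha; simp
      rcases Nat.eq_zero_or_pos b with hb | hb
      · subst hb; simp
      have e := alpha_rec (a + b)
      have e1 := alpha_rec a
      have e2 := alpha_rec b
      have i1 := ih (a / 2) (b / 2) (by omega)
      by_cases hc : a % 2 = 1 ∧ b % 2 = 1
      · have i2 := ih (a / 2 + b / 2) 1 (by omega)
        have e3 : (a + b) / 2 = a / 2 + b / 2 + 1 := by omega
        have := alpha_le_self 1
        rw [e3] at e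
        omega
      · have e3 : (a + b) / 2 = a / 2 + b / 2 := by omega
        rw [e3] at e
        omega
  exact fun b => key _ a b le_rfl

theorem key_lemma (K : ℕ) : ∀ r : ℕ → ℕ,
    alpha (∑ j ∈ Finset.range K, r j * 2 ^ j) ≤ ∑ j ∈ Finset.range K, r j ∧
    (alpha (∑ j ∈ Finset.range K, r j * 2 ^ j) = ∑ j ∈ Finset.range K, r j →
      ∀ j < K, r j = eps (∑ j ∈ Finset.range K, r j * 2 ^ j) j) := by
  induction K with
  | zero => intro r; simp [alpha_zero']
  | succ K ih =>
    intro r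
    obtain ⟨h1, h2⟩ := ih (fun j => r (j + 1))
    have e : ∑ j ∈ Finset.range (K + 1), r j * 2 ^ j
        = 2 * (∑ j ∈ Finset.range K, r (j + 1) * 2 ^ j) + r 0 := by
      rw [Finset.sum_range_succ', Finset.mul_sum]
      congr 1
      · exact Finset.sum_congr rfl fun j _ => by ring
      · simp
    rw [e, Finset.sum_range_succ']
    set N := ∑ j ∈ Finset.range K, r (j + 1) * 2 ^ j
    set S := ∑ j ∈ Finset.range K, r (j + 1)
    have a1 := alpha_rec (2 * N + r 0)
    have a2 : (2 * N + r 0) / 2 = N + r 0 / 2 := by omega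
    have a3 := alpha_add N (r 0 / 2)
    have a4 := alpha_le_self (r 0 / 2)
    rw [a2] at a1
    refine ⟨by omega, fun h j hj => ?_⟩
    have q : r 0 / 2 = 0 := by omega
    cases j with
    | zero => simp only [eps, pow_zero, Nat.div_one]; omega
    | succ j =>
      have := h2 (by omega) j (by omega)
      rw [this]
      unfold eps
      rw [pow_succ', ← Nat.div_div_eq_div_mul, a2, q, add_zero]

theorem stmt11 (n : ℕ) (hn : 0 < n) (h4 : n % 4 = 0)
    (r : ℕ → ℕ) (hr0 : r 0 = 0) (hfin : (Function.support r).Finite)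
    (hr1 : 2 ∣ r 1)
    (ℓ : ℕ) (hℓ : ℓ ≤ alpha n)
    (hsum : ∑ᶠ j, r j * (2 ^ j - 1) = n - ℓ)
    (hcard : ∑ᶠ j, r j ≤ ℓ) :
    ℓ = alpha n ∧ ∀ j, 1 ≤ j → r j = eps n j := by
  obtain ⟨B, hB⟩ := hfin.bddAbove
  have main : ∀ K, B < K → ℓ = alpha n ∧ ∀ j < K, r j = eps n j := by
    intro K hK
    have s0 : Function.support r ⊆ ↑(Finset.range K) := by
      intro j hj
      have := hB hj
      simp; omega
    have s1 : Function.support (fun j => r j * (2 ^ j - 1)) ⊆ ↑(Finset.range K) := by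
      intro j hj
      apply s0
      intro h
      apply hj
      simp [h]
    rw [finsum_eq_sum_of_support_subset _ s1] at hsum
    rw [finsum_eq_sum_of_support_subset _ s0] at hcard
    have e : ∑ j ∈ Finset.range K, r j * 2 ^ j
        = ∑ j ∈ Finset.range K, r j * (2 ^ j - 1) + ∑ j ∈ Finset.range K, r j := by
      rw [← Finset.sum_add_distrib]
      refine Finset.sum_congr rfl fun j _ => ?_
      have : 2 ^ j = (2 ^ j - 1) + 1 := (Nat.sub_add_cancel Nat.one_le_two_pow).symm
      conv_lhs => rw [this]
      ring
    have ev : 2 ∣ ∑ j ∈ Finset.range K, r j * 2 ^ j := by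
      refine Finset.dvd_sum fun j _ => ?_
      cases j with
      | zero => simp [hr0]
      | succ j => exact Dvd.dvd.mul_left (Dvd.intro_left _ (pow_succ 2 j).symm) _
    obtain ⟨k1, k2⟩ := key_lemma K r
    set N := ∑ j ∈ Finset.range K, r j * 2 ^ j
    set m := ∑ j ∈ Finset.range K, r j
    have hl := alpha_le_self n
    obtain ⟨d, hd⟩ := Nat.exists_eq_add_of_le hcard
    have hN : n = N + d := by omega
    have a := alpha_add N d
    rw [← hN] at a
    have b := alpha_rec d
    have c := alpha_le_self (d / 2)
    have c' := alpha_le_self d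
    have d0 : d = 0 := by omega
    have hnN : n = N := by omega
    rw [← hnN] at k1 k2
    exact ⟨by omega, k2 (by omega)⟩
  exact ⟨(main (B + 1) (by omega)).1, fun j _ => (main (B + 1 + j) (by omega)).2 j (by omega)⟩
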